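/- arXiv:1603.07122 — 8 statements merged into one kernel-verified Lean document; each statement's English description precedes it below -/
import Mathlib

section
/- Let J be a 2×2 real matrix and τ > 0 a real number. Then every complex number λ satisfying the quasi-polynomial characteristic equation λ² − (tr J) λ e^{−λτ} + (det J) e^{−2λτ} = 0 has strictly negative real part if and only if both conditions hold: (i) 2 √(det J) · sin(τ √(det J)) < −tr J < π/(2τ) + 2τ det J / π, and (ii) 0 < τ² det J < (π/2)². -/
open Real Matrix

lemma aux_suff (z : ℂ) (h1 : ‖z * Complex.exp z‖ < π / 2)
    (h2 : ‖z * Complex.exp z‖ * Real.sin ‖z * Complex.exp z‖ < -(z * Complex.exp z).re) :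
    z.re < 0 := by
  by_contra hx
  push Not at hx
  set r := ‖z * Complex.exp z‖ with hr
  have hr' : r = ‖z‖ * Real.exp z.re := by
    rw [hr, norm_mul, Complex.norm_exp]
  have he : 1 ≤ Real.exp z.re := Real.one_le_exp hx
  have hy : |z.im| ≤ ‖z‖ := Complex.abs_im_le_norm z
  have hyr : |z.im| * Real.exp z.re ≤ r := by
    rw [hr']; gcongr
  have hyr2 : |z.im| ≤ r := by nlinarith [abs_nonneg z.im]
  have hcos : 0 ≤ Real.cos z.im := by
    rw [← Real.cos_abs]
    apply Real.cos_nonneg_of_mem_Icc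
    constructor <;> linarith [abs_nonneg z.im, Real.pi_pos]
  have hsin : Real.sin |z.im| ≤ Real.sin r :=
    Real.sin_le_sin_of_le_of_le_pi_div_two (by linarith [abs_nonneg z.im, Real.pi_pos]) h1.le hyr2
  have hsin0 : 0 ≤ Real.sin |z.im| :=
    Real.sin_nonneg_of_nonneg_of_le_pi (abs_nonneg _) (by linarith [Real.pi_pos])
  have hys : z.im * Real.sin z.im = |z.im| * Real.sin |z.im| := by
    rcases abs_cases z.im with ⟨h, _⟩ | ⟨h, _⟩ <;> rw [h]
    rw [Real.sin_neg]; ring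
  have hre : (z * Complex.exp z).re
      = Real.exp z.re * (z.re * Real.cos z.im) - |z.im| * Real.exp z.re * Real.sin |z.im| := by
    rw [Complex.mul_re, Complex.exp_re, Complex.exp_im]
    linear_combination (-Real.exp z.re) * hys
  have h3 : |z.im| * Real.exp z.re * Real.sin |z.im| ≤ r * Real.sin r := by
    have : 0 ≤ r := norm_nonneg _
    gcongr
  have h4 : 0 ≤ Real.exp z.re * (z.re * Real.cos z.im) := by positivity
  linarith

lemma aux_ex (r θ : ℝ) (hr : 0 ≤ r) (h0 : 0 ≤ θ) (hpi : θ ≤ π) (h : θ - π / 2 ≤ r) :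
    ∃ z : ℂ, 0 ≤ z.re ∧ z * Complex.exp z = r * Complex.exp (θ * Complex.I) := by
  rcases h0.eq_or_lt with h0 | h0
  · subst h0
    have hc : ContinuousOn (fun x : ℝ => x * Real.exp x) (Set.Icc 0 r) := by fun_prop
    obtain ⟨x, hx, hx2⟩ := intermediate_value_Icc hr hc
      (show r ∈ _ from ⟨by simpa using hr, by
        have := Real.one_le_exp hr
        show r ≤ r * Real.exp r
        nlinarith⟩)
    refine ⟨x, by simpa using hx.1, ?_⟩
    simp only at hx2
    rw [← hx2]; push_cast; simp
  · set a := θ / (2 + r) with ha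
    set b := min θ (π / 2) with hb
    have hpp := Real.pi_pos
    have ha0 : 0 < a := by positivity
    have hab : a ≤ b := by
      apply le_min
      · rw [ha, div_le_iff₀ (by positivity)]; nlinarith
      · rw [ha, div_le_iff₀ (by positivity)]; nlinarith
    have hbpi : b ≤ π / 2 := min_le_right _ _
    have hbθ : b ≤ θ := min_le_left _ _
    have hspos : ∀ x ∈ Set.Icc a b, 0 < Real.sin x := fun x hx =>
      Real.sin_pos_of_pos_of_lt_pi (by linarith [hx.1]) (by linarith [hx.2])
    have hc : ContinuousOn (fun x : ℝ => ((θ - x) / Real.sin x) *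
        Real.exp (((θ - x) / Real.sin x) * Real.cos x)) (Set.Icc a b) := by
      have h1 : ContinuousOn (fun x : ℝ => ((θ - x) / Real.sin x)) (Set.Icc a b) :=
        ContinuousOn.div (by fun_prop) (by fun_prop) (fun x hx => (hspos x hx).ne')
      fun_prop
    have hcos : ∀ x ∈ Set.Icc a b, 0 ≤ Real.cos x := fun x hx =>
      Real.cos_nonneg_of_mem_Icc ⟨by linarith [hx.1], by linarith [hx.2]⟩
    have hmem : r ∈ Set.Icc (((θ - b) / Real.sin b) *
        Real.exp (((θ - b) / Real.sin b) * Real.cos b)) (((θ - a) / Real.sin a) *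
        Real.exp (((θ - a) / Real.sin a) * Real.cos a)) := by
      constructor
      · rcases le_total θ (π / 2) with hh | hh
        · have : b = θ := min_eq_left hh
          rw [this]; simpa using hr
        · have : b = π / 2 := min_eq_right hh
          rw [this]; simpa using h
      · have hs := hspos a ⟨le_rfl, hab⟩
        have hco := hcos a ⟨le_rfl, hab⟩
        have h1 : 1 + r ≤ (θ - a) / Real.sin a := by
          rw [le_div_iff₀ hs]
          have : Real.sin a ≤ a := Real.sin_le ha0.le
          have h2 : a * (2 + r) = θ := by rw [ha]; field_simp
          nlinarith
        have h3 : 1 ≤ Real.exp (((θ - a) / Real.sin a) * Real.cos a) :=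
          Real.one_le_exp (mul_nonneg (by linarith) hco)
        nlinarith
    obtain ⟨x, hx, hx2⟩ := intermediate_value_Icc' hab hc hmem
    simp only at hx2
    set ρ := (θ - x) / Real.sin x with hρ
    have hs := hspos x hx
    have hρ0 : 0 ≤ ρ := div_nonneg (by linarith [hx.2]) hs.le
    have hρs : ρ * Real.sin x = θ - x := by rw [hρ]; field_simp
    have hθ : θ = x + ρ * Real.sin x := by linarith
    refine ⟨ρ * Complex.exp (x * Complex.I), ?_, ?_⟩
    · rw [Complex.re_ofReal_mul, Complex.exp_ofReal_mul_I_re]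
      exact mul_nonneg hρ0 (hcos x hx)
    · have e1 : (ρ : ℂ) * Complex.exp (x * Complex.I)
          = (ρ * Real.cos x : ℝ) + (ρ * Real.sin x : ℝ) * Complex.I := by
        rw [Complex.exp_mul_I]; push_cast; ring
      have e2 : Complex.exp ((ρ : ℂ) * Complex.exp (x * Complex.I))
          = Complex.exp ((ρ * Real.cos x : ℝ) : ℂ) * Complex.exp ((ρ * Real.sin x : ℝ) * Complex.I) := by
        rw [e1, Complex.exp_add]
      have e3 : Complex.exp (θ * Complex.I) = Complex.exp (x * Complex.I) *
          Complex.exp ((ρ * Real.sin x : ℝ) * Complex.I) := by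
        rw [← Complex.exp_add, ← add_mul, ← Complex.ofReal_add, ← hθ]
      have e4 : (r : ℂ) = ρ * Complex.exp ((ρ * Real.cos x : ℝ) : ℂ) := by
        rw [← hx2]; push_cast; rfl
      rw [e2, e3, e4]; ring

lemma aux_nec (μ : ℂ) (H : ∀ z : ℂ, z * Complex.exp z = μ → z.re < 0) :
    ‖μ‖ < π / 2 ∧ ‖μ‖ * Real.sin ‖μ‖ < -μ.re := by
  wlog him : 0 ≤ μ.im generalizing μ
  · have := this ((starRingEnd ℂ) μ) (fun z hz => by
      have h2 := H ((starRingEnd ℂ) z) (by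
        rw [Complex.exp_conj, ← map_mul, hz, Complex.conj_conj])
      simpa using h2) (by simp; linarith)
    simpa using this
  by_contra hcon
  have hre : μ.re = ‖μ‖ * Real.cos μ.arg := (Complex.norm_mul_cos_arg μ).symm
  have harg0 : 0 ≤ μ.arg := Complex.arg_nonneg_iff.2 him
  have hargpi := Complex.arg_le_pi μ
  have hn := norm_nonneg μ
  by_cases h0 : μ = 0
  · have := H 0 (by simp [h0])
    simp at this
  have hn' : 0 < ‖μ‖ := norm_pos_iff.2 h0
  have key : μ.arg - π / 2 ≤ ‖μ‖ := by
    by_contra hk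
    push Not at hk
    apply hcon
    refine ⟨by linarith, ?_⟩
    have : Real.cos μ.arg < Real.cos (‖μ‖ + π / 2) :=
      Real.cos_lt_cos_of_nonneg_of_le_pi (by linarith [Real.pi_pos]) hargpi (by linarith)
    rw [Real.cos_add_pi_div_two] at this
    rw [hre]
    nlinarith
  obtain ⟨z, hz, hz2⟩ := aux_ex ‖μ‖ μ.arg hn harg0 hargpi key
  rw [Complex.norm_mul_exp_arg_mul_I] at hz2
  linarith [H z hz2]

lemma aux_iff (μ : ℂ) : (∀ z : ℂ, z * Complex.exp z = μ → z.re < 0) ↔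
    ‖μ‖ < π / 2 ∧ ‖μ‖ * Real.sin ‖μ‖ < -μ.re :=
  ⟨aux_nec μ, fun h z hz => by subst hz; exact aux_suff z h.1 h.2⟩

lemma aux_real (p : ℝ) : (‖(p : ℂ)‖ < π / 2 ∧ ‖(p : ℂ)‖ * Real.sin ‖(p : ℂ)‖ < -p) ↔
    (-(π / 2) < p ∧ p < 0) := by
  rw [Complex.norm_real, Real.norm_eq_abs]
  constructor
  · rintro ⟨h1, h2⟩
    refine ⟨(abs_lt.1 h1).1, ?_⟩
    have : 0 ≤ Real.sin |p| :=
      Real.sin_nonneg_of_nonneg_of_le_pi (abs_nonneg _) (by linarith [Real.pi_pos])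
    nlinarith [abs_nonneg p]
  · rintro ⟨h1, h2⟩
    rw [abs_of_neg h2]
    refine ⟨by linarith, ?_⟩
    have : Real.sin (-p) < -p := Real.sin_lt (by linarith)
    have h3 : Real.sin (-p) < 1 := by
      rw [← Real.sin_pi_div_two]
      exact Real.sin_lt_sin_of_lt_of_le_pi_div_two (by linarith [Real.pi_pos]) le_rfl (by linarith)
    nlinarith

lemma aux_main (T D : ℝ) (m n : ℂ) (hs : m + n = T) (hp : m * n = D) :
    ((‖m‖ < π / 2 ∧ ‖m‖ * Real.sin ‖m‖ < -m.re) ∧ (‖n‖ < π / 2 ∧ ‖n‖ * Real.sin ‖n‖ < -n.re)) ↔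
    ((2 * √D * Real.sin √D < -T ∧ -T < π / 2 + 2 * D / π) ∧ (0 < D ∧ D < (π / 2) ^ 2)) := by
  have hpp := Real.pi_pos
  have s1 := congrArg Complex.re hs
  have s2 := congrArg Complex.im hs
  have p2 := congrArg Complex.im hp
  have p1 := congrArg Complex.re hp
  simp only [Complex.add_re, Complex.add_im, Complex.mul_re, Complex.mul_im, Complex.ofReal_re,
    Complex.ofReal_im] at s1 s2 p1 p2
  have hni : n.im = -m.im := by linarith
  by_cases hm : m.im = 0
  · have hm' : m = (m.re : ℂ) := Complex.ext (by simp) (by simp [hm])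
    have hn' : n = (n.re : ℂ) := Complex.ext (by simp) (by simp [hni, hm])
    generalize m.re = p at *
    generalize n.re = q at *
    subst hm' hn'
    rw [aux_real, aux_real]
    have hD : D = p * q := by simp at p1; linarith
    have hid : π / 2 + 2 * D / π + T = 2 / π * ((π / 2 + p) * (π / 2 + q)) := by
      rw [hD, ← s1]; field_simp; ring
    constructor
    · rintro ⟨⟨a1, a2⟩, b1, b2⟩
      have hD0 : 0 < D := by rw [hD]; exact mul_pos_of_neg_of_neg a2 b2
      have hDl : D < (π / 2) ^ 2 := by rw [hD]; nlinarith
      refine ⟨⟨?_, ?_⟩, hD0, hDl⟩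
      · have hr0 : 0 < √D := Real.sqrt_pos.2 hD0
        have hrl : √D < π / 2 := (Real.sqrt_lt' (by positivity)).2 hDl
        have h3 : Real.sin √D < 1 := by
          rw [← Real.sin_pi_div_two]
          exact Real.sin_lt_sin_of_lt_of_le_pi_div_two (by linarith) le_rfl hrl
        have h4 : 2 * √D ≤ -T := by
          refine le_of_pow_le_pow_left₀ two_ne_zero (by linarith) ?_
          rw [mul_pow, Real.sq_sqrt hD0.le, hD, ← s1]
          nlinarith [sq_nonneg (p - q)]
        nlinarith
      · have : 0 < 2 / π * ((π / 2 + p) * (π / 2 + q)) :=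
          mul_pos (by positivity) (mul_pos (by linarith) (by linarith))
        linarith
    · rintro ⟨⟨h1, h2⟩, hD0, hDl⟩
      have hr0 : 0 < √D := Real.sqrt_pos.2 hD0
      have hrl : √D < π / 2 := (Real.sqrt_lt' (by positivity)).2 hDl
      have h3 : 0 < Real.sin √D := Real.sin_pos_of_pos_of_lt_pi hr0 (by linarith)
      have h4 : p + q < 0 := by
        have : 0 < 2 * √D * Real.sin √D := by positivity
        linarith
      rw [hD] at hD0 hDl
      have h5 : 0 < (π / 2 + p) * (π / 2 + q) := by
        have : 0 < 2 / π * ((π / 2 + p) * (π / 2 + q)) := by linarith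
        exact (mul_pos_iff_of_pos_left (by positivity)).1 this
      have hp0 : p < 0 := by
        by_contra hc; push Not at hc
        nlinarith
      have hq0 : q < 0 := by nlinarith
      rcases pos_and_pos_or_neg_and_neg_of_mul_pos h5 with ⟨ha, hb⟩ | ⟨ha, hb⟩
      · exact ⟨⟨by linarith, hp0⟩, by linarith, hq0⟩
      · exfalso; nlinarith
  · have hre : n.re = m.re := by
      have : m.im * (n.re - m.re) = 0 := by rw [hni] at p2; linarith
      rcases mul_eq_zero.1 this with h | h
      · exact absurd h hm
      · linarith
    have hnn : ‖n‖ = ‖m‖ := by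
      rw [show n = (starRingEnd ℂ) m from Complex.ext (by simpa using hre) (by simpa using hni)]
      simp
    have hD : D = ‖m‖ ^ 2 := by
      rw [← Complex.normSq_eq_norm_sq, Complex.normSq_apply, ← p1, hre, hni]; ring
    have hsq : √D = ‖m‖ := by rw [hD, Real.sqrt_sq (norm_nonneg _)]
    have hT : T = 2 * m.re := by linarith
    have hmp : 0 < ‖m‖ := norm_pos_iff.2 (by rintro rfl; simp at hm)
    rw [hnn, hre, and_self_iff, hsq, hT]
    constructor
    · rintro ⟨h1, h2⟩
      refine ⟨⟨by linarith, ?_⟩, by rw [hD]; positivity, by rw [hD]; gcongr⟩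
      have h3 : -m.re ≤ ‖m‖ := (neg_le_abs _).trans (Complex.abs_re_le_norm m)
      have h4 : π / 2 + 2 * D / π - 2 * ‖m‖ = 2 / π * (π / 2 - ‖m‖) ^ 2 := by
        rw [hD]; field_simp; ring
      have h5 : 0 < 2 / π * (π / 2 - ‖m‖) ^ 2 :=
        mul_pos (by positivity) (pow_pos (by linarith) 2)
      linarith
    · rintro ⟨⟨h1, h2⟩, h3, h4⟩
      refine ⟨?_, by linarith⟩
      rw [hD] at h4
      exact lt_of_pow_lt_pow_left₀ 2 (by positivity) h4

/-- Stability criterion (Hara et al.) for the delay system `x'(t) = J x(t-τ)`: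
all characteristic roots of `λ² - (tr J) λ e^{-λτ} + (det J) e^{-2λτ} = 0`
have negative real part iff the Hara–Matsunaga conditions hold. -/
theorem stmt_0 (J : Matrix (Fin 2) (Fin 2) ℝ) (τ : ℝ) (hτ : 0 < τ) :
    (∀ lam : ℂ,
        lam ^ 2 - (J.trace : ℂ) * lam * Complex.exp (-(lam * (τ : ℂ)))
          + (J.det : ℂ) * Complex.exp (-(2 * lam * (τ : ℂ))) = 0 → lam.re < 0)
      ↔
    ((2 * Real.sqrt J.det * Real.sin (τ * Real.sqrt J.det) < -J.trace ∧
        -J.trace < Real.pi / (2 * τ) + 2 * τ * J.det / Real.pi) ∧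
      (0 < τ ^ 2 * J.det ∧ τ ^ 2 * J.det < (Real.pi / 2) ^ 2)) := by
  generalize J.trace = t
  generalize J.det = d
  have hpp := Real.pi_pos
  obtain ⟨s, hs⟩ := IsAlgClosed.exists_pow_nat_eq (((τ * t) ^ 2 - 4 * (τ ^ 2 * d) : ℝ) : ℂ)
    (n := 2) (by norm_num)
  push_cast at hs
  have hS : ((τ * t : ℂ) + s) / 2 + ((τ * t : ℂ) - s) / 2 = ((τ * t : ℝ) : ℂ) := by
    push_cast; ring
  have hP : (((τ * t : ℂ) + s) / 2) * (((τ * t : ℂ) - s) / 2) = ((τ ^ 2 * d : ℝ) : ℂ) := by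
    push_cast; linear_combination (-1 / 4) * hs
  have main := aux_main _ _ _ _ hS hP
  generalize ((τ * t : ℂ) + s) / 2 = m at *
  generalize ((τ * t : ℂ) - s) / 2 = n at *
  push_cast at hS hP
  have hτ' : (τ : ℂ) ≠ 0 := by exact_mod_cast hτ.ne'
  have hsqrt : √(τ ^ 2 * d) = τ * √d := by
    rw [Real.sqrt_mul (by positivity), Real.sqrt_sq hτ.le]
  have e1 : (2 * √d * Real.sin (τ * √d) < -t) ↔
      (2 * √(τ ^ 2 * d) * Real.sin √(τ ^ 2 * d) < -(τ * t)) := by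
    rw [hsqrt, ← mul_lt_mul_iff_right₀ hτ]
    ring_nf
  have e2 : (-t < π / (2 * τ) + 2 * τ * d / π) ↔
      (-(τ * t) < π / 2 + 2 * (τ ^ 2 * d) / π) := by
    rw [← mul_lt_mul_iff_right₀ hτ]
    have : τ * (π / (2 * τ) + 2 * τ * d / π) = π / 2 + 2 * (τ ^ 2 * d) / π := by
      field_simp
    rw [this]
    ring_nf
  rw [e1, e2, ← main, ← aux_iff, ← aux_iff]
  have fac : ∀ lam : ℂ, (lam ^ 2 - (t : ℂ) * lam * Complex.exp (-(lam * (τ : ℂ)))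
          + (d : ℂ) * Complex.exp (-(2 * lam * (τ : ℂ))) = 0) ↔
      ((lam * τ) * Complex.exp (lam * τ) = m ∨ (lam * τ) * Complex.exp (lam * τ) = n) := by
    intro lam
    have hE : Complex.exp (lam * τ) * Complex.exp (-(lam * τ)) = 1 := by
      rw [← Complex.exp_add]; simp
    have hE2 : Complex.exp (-(2 * lam * (τ : ℂ))) = Complex.exp (-(lam * τ)) ^ 2 := by
      rw [← Complex.exp_nat_mul]; congr 1; push_cast; ring
    have hne := Complex.exp_ne_zero (-(lam * (τ : ℂ)))
    rw [hE2]
    generalize Complex.exp (-(lam * τ)) = E at *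
    generalize Complex.exp (lam * τ) = F at *
    rw [← sub_eq_zero (b := m), ← sub_eq_zero (b := n), ← mul_eq_zero]
    have : (lam * τ * F - m) * (lam * τ * F - n) * E ^ 2
        = τ ^ 2 * (lam ^ 2 - t * lam * E + d * E ^ 2) := by
      linear_combination (lam ^ 2 * τ ^ 2 * (F * E + 1) - lam * τ * E * τ * t) * hE
        - lam * τ * F * E ^ 2 * hS + E ^ 2 * hP
    constructor
    · intro h
      rw [h, mul_zero] at this
      exact (mul_eq_zero.1 this).resolve_right (pow_ne_zero 2 hne)
    · intro h
      rw [h, zero_mul] at this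
      exact (mul_eq_zero.1 this.symm).resolve_left (pow_ne_zero 2 hτ')
  have hre : ∀ z : ℂ, (z / τ).re < 0 ↔ z.re < 0 := by
    intro z
    rw [Complex.div_ofReal_re, div_lt_iff₀ hτ, zero_mul]
  constructor
  · intro H
    refine ⟨fun z hz => ?_, fun z hz => ?_⟩
    · exact (hre z).1 (H _ ((fac _).2 (by rw [div_mul_cancel₀ _ hτ']; exact Or.inl hz)))
    · exact (hre z).1 (H _ ((fac _).2 (by rw [div_mul_cancel₀ _ hτ']; exact Or.inr hz)))
  · rintro ⟨H1, H2⟩ lam hl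
    have : (lam * τ).re < 0 := by
      rcases (fac lam).1 hl with h | h
      · exact H1 _ h
      · exact H2 _ h
    have h2 := (hre (lam * τ)).2 this
    rwa [mul_div_cancel_right₀ _ hτ'] at h2
end

section
/- For every nonzero complex number z there exists a complex number w₀ with w₀ e^{w₀} = z and |Im w₀| ≤ π such that every complex number w satisfying w e^{w} = z has Re w ≤ Re w₀. (Equivalently, among all branches of the Lambert W function, the principal branch W₀ attains the maximal real part: max_{k ∈ ℤ} Re W_k(z) = Re W₀(z).) -/
noncomputable def lamS (r x : ℝ) : ℝ := Real.sqrt (r^2 * Real.exp (-x)^2 - x^2)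
noncomputable def lamF (r x : ℝ) : ℝ := Real.arccos (x * Real.exp x / r) + lamS r x

lemma lamF_cont (r : ℝ) : Continuous (lamF r) := by
  unfold lamF lamS
  have : Continuous fun x : ℝ => x * Real.exp x / r := by fun_prop
  exact (Real.continuous_arccos.comp this).add (by fun_prop)

lemma lam_key (r x : ℝ) (hr : 0 < r) (h : |x * Real.exp x| ≤ r) :
    Real.exp x * (x * Real.cos (lamS r x) - lamS r x * Real.sin (lamS r x)) = r * Real.cos (lamF r x)
    ∧ Real.exp x * (x * Real.sin (lamS r x) + lamS r x * Real.cos (lamS r x)) = r * Real.sin (lamF r x) := by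
  have h' := abs_le.1 h
  have he := Real.exp_pos x
  have hc : Real.cos (Real.arccos (x * Real.exp x / r)) = x * Real.exp x / r := by
    apply Real.cos_arccos
    · rw [le_div_iff₀ hr]; linarith
    · rw [div_le_iff₀ hr]; linarith
  have hs : Real.sin (Real.arccos (x * Real.exp x / r)) = lamS r x * Real.exp x / r := by
    rw [Real.sin_arccos]
    have : 1 - (x * Real.exp x / r)^2 = (r^2 * Real.exp (-x)^2 - x^2) * (Real.exp x / r)^2 := by
      rw [Real.exp_neg]; field_simp
    rw [this, Real.sqrt_mul' _ (sq_nonneg _), Real.sqrt_sq (by positivity), lamS]; ring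
  have hF : lamF r x = Real.arccos (x * Real.exp x / r) + lamS r x := rfl
  rw [hF, Real.cos_add, Real.sin_add, hc, hs]
  constructor <;> field_simp
  ring

lemma lam_interval (r : ℝ) (hr : 0 < r) : ∃ a b : ℝ, a ≤ b ∧ (∀ x ∈ Set.Icc a b, |x * Real.exp x| ≤ r) ∧
    Real.pi ≤ lamF r a ∧ lamF r b = 0 ∧ ∀ x, |x * Real.exp x| ≤ r → x ≤ b := by
  obtain ⟨b, hb, hb2⟩ : ∃ b ∈ Set.Icc 0 r, b * Real.exp b = r := by
    have hc : ContinuousOn (fun x : ℝ => x * Real.exp x) (Set.Icc 0 r) := by fun_prop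
    have := intermediate_value_Icc hr.le hc
    apply this
    constructor
    · simp [hr.le]
    · have := Real.one_le_exp hr.le
      show r ≤ r * Real.exp r
      nlinarith
  have hb0 := hb.1
  have hpos : ∀ x, 0 ≤ x → x ≤ b → |x * Real.exp x| ≤ r := by
    intro x h0 h1
    rw [abs_of_nonneg (by positivity), ← hb2]
    gcongr
  have hFb : lamF r b = 0 := by
    have h1 : b * Real.exp b / r = 1 := by rw [hb2, div_self hr.ne']
    have h2 : r^2 * Real.exp (-b)^2 - b^2 = 0 := by
      rw [← hb2, Real.exp_neg]; field_simp; ring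
    rw [lamF, lamS, h1, h2]; simp
  have hmax : ∀ x, |x * Real.exp x| ≤ r → x ≤ b := by
    intro x hx
    by_contra! hlt
    have h1 := (abs_le.1 hx).2
    have h2 : Real.exp b < Real.exp x := Real.exp_lt_exp.2 hlt
    have h3 := Real.exp_pos b
    nlinarith
  have habs : ∀ x : ℝ, x ≤ 0 → |x * Real.exp x| = (-x) * Real.exp x := by
    intro x hx
    rw [abs_of_nonpos (mul_nonpos_of_nonpos_of_nonneg hx (Real.exp_pos x).le)]; ring
  rcases le_total (Real.exp (-1)) r with h | h
  · refine ⟨-4, b, by linarith, ?_, ?_, hFb, hmax⟩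
    · intro x hx
      rcases le_total 0 x with h0 | h0
      · exact hpos x h0 hx.2
      · rw [habs x h0]
        refine le_trans ?_ h
        have h1 := Real.add_one_le_exp (-1 - x)
        have h2 : Real.exp (-1) = Real.exp (-1 - x) * Real.exp x := by
          rw [← Real.exp_add]; ring_nf
        rw [h2]
        gcongr
        linarith
    · have hsq : Real.pi ≤ lamS r (-4) := by
        apply Real.le_sqrt_of_sq_le
        have h1 : Real.exp 3 ≤ r * Real.exp (- -4) := by
          have : Real.exp 3 = Real.exp (-1) * Real.exp (- -4) := by
            rw [← Real.exp_add]; norm_num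
          rw [this]; gcongr
        have h2 : (8:ℝ) ≤ Real.exp 3 := by
          have h3 := Real.add_one_le_exp (1:ℝ)
          have : Real.exp 3 = Real.exp 1 ^ 3 := by rw [← Real.exp_nat_mul]; norm_num
          rw [this]
          calc (8:ℝ) = 2^3 := by norm_num
            _ ≤ _ := by gcongr; linarith
        have := Real.pi_lt_d2
        have := Real.pi_pos
        nlinarith
      have := Real.arccos_nonneg (-4 * Real.exp (-4) / r)
      unfold lamF; linarith
  · obtain ⟨t, ht, ht2⟩ : ∃ t ∈ Set.Icc (0:ℝ) 1, t * Real.exp (-t) = r := by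
      have hc : ContinuousOn (fun x : ℝ => x * Real.exp (-x)) (Set.Icc 0 1) := by fun_prop
      apply intermediate_value_Icc zero_le_one hc
      constructor
      · simp [hr.le]
      · simpa using h
    refine ⟨-t, b, by linarith [ht.1], ?_, ?_, hFb, hmax⟩
    · intro x hx
      rcases le_total 0 x with h0 | h0
      · exact hpos x h0 hx.2
      · rw [habs x h0, ← ht2]
        have h1 := Real.add_one_le_exp (-t - x)
        have h2 : Real.exp (-t) = Real.exp (-t - x) * Real.exp x := by
          rw [← Real.exp_add]; ring_nf
        rw [h2, ← mul_assoc]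
        gcongr
        have := hx.1
        have h01 := ht.1
        have h02 := ht.2
        nlinarith
    · have h1 : -t * Real.exp (-t) / r = -1 := by rw [neg_mul, ht2, neg_div, div_self hr.ne']
      have : 0 ≤ lamS r (-t) := Real.sqrt_nonneg _
      rw [lamF, h1, Real.arccos_neg_one]; linarith

lemma lam_re (w : ℂ) : (w * Complex.exp w).re = Real.exp w.re * (w.re * Real.cos w.im - w.im * Real.sin w.im) := by
  rw [Complex.mul_re, Complex.exp_re, Complex.exp_im]; ring

lemma lam_im (w : ℂ) : (w * Complex.exp w).im = Real.exp w.re * (w.re * Real.sin w.im + w.im * Real.cos w.im) := by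
  rw [Complex.mul_im, Complex.exp_re, Complex.exp_im]; ring

/-- Dominance of the principal branch of the Lambert `W` function: for every nonzero
`z ∈ ℂ` there is a solution `w₀` of `w e^w = z` with `|Im w₀| ≤ π` whose real part
dominates the real part of every other solution. -/
theorem stmt_2 (z : ℂ) (hz : z ≠ 0) :
    ∃ w₀ : ℂ, w₀ * Complex.exp w₀ = z ∧ |w₀.im| ≤ Real.pi ∧
      ∀ w : ℂ, w * Complex.exp w = z → w.re ≤ w₀.re := by
  obtain ⟨r, hrz⟩ : ∃ r, r = ‖z‖ := ⟨_, rfl⟩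
  have hr : 0 < r := by rw [hrz]; exact norm_pos_iff.2 hz
  have hr2 : r^2 = z.re^2 + z.im^2 := by
    rw [hrz, Complex.sq_norm, Complex.normSq_apply]; ring
  obtain ⟨θ, hθ⟩ : ∃ θ, θ = Real.arccos (z.re / r) := ⟨_, rfl⟩
  have hre := abs_le.1 (hrz ▸ Complex.abs_re_le_norm z)
  have hcos : r * Real.cos θ = z.re := by
    rw [hθ, Real.cos_arccos]
    · field_simp
    · rw [le_div_iff₀ hr]; linarith
    · rw [div_le_iff₀ hr]; linarith
  have hsin : r * Real.sin θ = |z.im| := by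
    have h0 : 0 ≤ Real.sin θ := by rw [hθ, Real.sin_arccos]; exact Real.sqrt_nonneg _
    rw [← abs_of_nonneg (mul_nonneg hr.le h0)]
    apply (sq_eq_sq_iff_abs_eq_abs _ _).1
    have := Real.sin_sq_add_cos_sq θ
    rw [mul_pow]
    have h3 : z.re^2 = r^2 * Real.cos θ^2 := by rw [← hcos]; ring
    have h4 : r^2 * Real.sin θ^2 + r^2 * Real.cos θ^2 = r^2 := by rw [← mul_add, this, mul_one]
    linarith
  have hθ0 : 0 ≤ θ := hθ ▸ Real.arccos_nonneg _
  have hθπ : θ ≤ Real.pi := hθ ▸ Real.arccos_le_pi _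
  obtain ⟨a, b, hab, hI, hFa, hFb, hmax⟩ := lam_interval r hr
  have hcomp : IsCompact (Set.Icc a b ∩ {x | θ ≤ lamF r x}) :=
    isCompact_Icc.inter_right (isClosed_le continuous_const (lamF_cont r))
  obtain ⟨x₀, ⟨hx₀, hx₀F⟩, hx₀max⟩ := hcomp.exists_isGreatest
    ⟨a, ⟨le_refl a, hab⟩, hθπ.trans hFa⟩
  have hFx : lamF r x₀ = θ := by
    obtain ⟨x, hx, hxF⟩ := intermediate_value_Icc' hx₀.2 (lamF_cont r).continuousOn
      (show θ ∈ Set.Icc (lamF r b) (lamF r x₀) from ⟨hFb ▸ hθ0, hx₀F⟩)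
    have := hx₀max ⟨⟨hx₀.1.trans hx.1, hx.2⟩, hxF.ge⟩
    rw [le_antisymm hx.1 this, hxF]
  obtain ⟨k1, k2⟩ := lam_key r x₀ hr (hI x₀ hx₀)
  rw [hFx, hcos] at k1
  rw [hFx, hsin] at k2
  have hS0 : 0 ≤ lamS r x₀ := Real.sqrt_nonneg _
  have hSπ : lamS r x₀ ≤ Real.pi := by
    have := Real.arccos_nonneg (x₀ * Real.exp x₀ / r)
    unfold lamF at hFx; linarith
  have hdom : ∀ w : ℂ, w * Complex.exp w = z → w.re ≤ x₀ := by
    intro w hw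
    have hn : r = ‖w‖ * Real.exp w.re := by rw [hrz, ← hw, norm_mul, Complex.norm_exp]
    have habs : |w.re * Real.exp w.re| ≤ r := by
      rw [abs_mul, abs_of_pos (Real.exp_pos _), hn]
      gcongr
      exact Complex.abs_re_le_norm w
    have hS : lamS r w.re = |w.im| := by
      rw [← Real.sqrt_sq_eq_abs, lamS]
      congr 1
      have : r * Real.exp (-w.re) = ‖w‖ := by
        rw [hn, mul_assoc, ← Real.exp_add]; simp
      rw [← mul_pow, this, Complex.sq_norm, Complex.normSq_apply]; ring
    have hk := (lam_key r w.re hr habs).1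
    have hwre := lam_re w
    have heq : Real.cos (lamF r w.re) = Real.cos θ := by
      apply mul_left_cancel₀ hr.ne'
      rw [← hk, hcos, ← hw, hwre, hS]
      rcases abs_choice w.im with h | h <;> rw [h]
      simp
    have hF0 : 0 ≤ lamF r w.re := add_nonneg (Real.arccos_nonneg _) (Real.sqrt_nonneg _)
    by_contra! hlt
    have hge : θ ≤ lamF r w.re := by
      by_contra! hl
      exact absurd heq (Real.cos_lt_cos_of_nonneg_of_le_pi hF0 hθπ hl).ne'
    exact absurd (hx₀max ⟨⟨hx₀.1.trans hlt.le, hmax _ habs⟩, hge⟩) (not_le.2 hlt)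
  rcases le_total 0 z.im with h | h
  · refine ⟨⟨x₀, lamS r x₀⟩, ?_, ?_, hdom⟩
    · apply Complex.ext
      · rw [lam_re]; exact k1
      · rw [lam_im, ← abs_of_nonneg h]; exact k2
    · exact (abs_of_nonneg hS0).trans_le hSπ
  · refine ⟨⟨x₀, -lamS r x₀⟩, ?_, ?_, hdom⟩
    · rw [abs_of_nonpos h] at k2
      apply Complex.ext
      · rw [lam_re, ← k1]; simp
      · rw [lam_im, ← neg_neg z.im, ← k2]; simp; ring
    · rw [abs_neg]; exact (abs_of_nonneg hS0).trans_le hSπ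
end

section
/- Let τ > 0 and μ > 0 be real numbers. Then there exists a unique real λ with λ e^{τλ} = μ; this λ is strictly positive; and moreover every complex number w satisfying w e^{τw} = μ has Re w ≤ λ. -/
/-- For `τ > 0` and `μ > 0`, the characteristic equation `λ e^{τλ} = μ` has a unique
real solution, which is strictly positive, and every complex solution `w` satisfies
`Re w ≤ λ` (the real dominant root corresponds to a stationary unstable mode). -/
theorem stmt_4 (τ μ : ℝ) (hτ : 0 < τ) (hμ : 0 < μ) :
    ∃ lam : ℝ, lam * Real.exp (τ * lam) = μ ∧ 0 < lam ∧
      (∀ l : ℝ, l * Real.exp (τ * l) = μ → l = lam) ∧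
      (∀ w : ℂ, w * Complex.exp ((τ : ℂ) * w) = (μ : ℂ) → w.re ≤ lam) := by
  have mono : ∀ a b : ℝ, 0 < a → a < b →
      a * Real.exp (τ * a) < b * Real.exp (τ * b) := by
    intro a b ha hab
    have h1 : Real.exp (τ * a) < Real.exp (τ * b) :=
      Real.exp_lt_exp.mpr (mul_lt_mul_of_pos_left hab hτ)
    exact mul_lt_mul hab h1.le (Real.exp_pos _) (ha.trans hab).le
  have pos : ∀ l : ℝ, l * Real.exp (τ * l) = μ → 0 < l := by
    intro l hl
    exact pos_of_mul_pos_left (hl ▸ hμ) (Real.exp_pos _).le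
  have hc : ContinuousOn (fun x : ℝ => x * Real.exp (τ * x)) (Set.Icc 0 μ) := by
    fun_prop
  have hmem : μ ∈ Set.Icc ((fun x : ℝ => x * Real.exp (τ * x)) 0)
      ((fun x : ℝ => x * Real.exp (τ * x)) μ) := by
    refine ⟨by simpa using hμ.le, ?_⟩
    have : 1 ≤ Real.exp (τ * μ) := Real.one_le_exp (mul_pos hτ hμ).le
    show μ ≤ μ * Real.exp (τ * μ)
    nlinarith
  obtain ⟨lam, -, hlam⟩ := intermediate_value_Icc hμ.le hc hmem
  have hlam : lam * Real.exp (τ * lam) = μ := hlam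
  refine ⟨lam, hlam, pos lam hlam, ?_, ?_⟩
  · intro l hl
    rcases lt_trichotomy l lam with h | h | h
    · have := mono l lam (pos l hl) h
      linarith
    · exact h
    · have := mono lam l (pos lam hlam) h
      linarith
  · intro w hw
    by_contra! h
    have h1 := mono lam w.re (pos lam hlam) h
    have h2 : ‖w‖ * Real.exp (τ * w.re) = μ := by
      have := congrArg norm hw
      rw [norm_mul, Complex.norm_exp, Complex.re_ofReal_mul, Complex.norm_real,
        Real.norm_of_nonneg hμ.le] at this
      exact this
    have h3 := mul_le_mul_of_nonneg_right (Complex.re_le_norm w) (Real.exp_pos (τ * w.re)).le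
    linarith
end

section
/- Let τ > 0 and let μ be a real number. Then every complex number λ satisfying λ e^{τλ} = μ has strictly negative real part if and only if −π/(2τ) < μ < 0. -/
theorem aux_eq (τ μ a b : ℝ) (hτ : 0 < τ) :
    (((a : ℂ) + b * Complex.I) / τ) * Complex.exp ((τ : ℂ) * (((a : ℂ) + b * Complex.I) / τ)) = (μ : ℂ)
    ↔ (Real.exp a * (a * Real.cos b - b * Real.sin b) = τ * μ ∧
      Real.exp a * (a * Real.sin b + b * Real.cos b) = 0) := by
  have h0 : (τ : ℂ) ≠ 0 := by exact_mod_cast hτ.ne'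
  rw [mul_div_cancel₀ _ h0, div_mul_eq_mul_div, div_eq_iff h0, Complex.exp_add_mul_I,
    ← Complex.ofReal_exp, ← Complex.ofReal_cos, ← Complex.ofReal_sin, Complex.ext_iff]
  simp only [Complex.mul_re, Complex.mul_im, Complex.add_re, Complex.add_im, Complex.ofReal_re,
    Complex.ofReal_im, Complex.I_re, Complex.I_im]
  constructor
  · rintro ⟨h1, h2⟩
    constructor <;> linarith
  · rintro ⟨h1, h2⟩
    constructor <;> linarith

/-- Stability of the scalar delay equation `x'(t) = μ x(t-τ)`: every complex root of
`λ e^{τλ} = μ` has strictly negative real part iff `-π/(2τ) < μ < 0`. -/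
theorem stmt_5 (τ μ : ℝ) (hτ : 0 < τ) :
    (∀ lam : ℂ, lam * Complex.exp ((τ : ℂ) * lam) = (μ : ℂ) → lam.re < 0)
      ↔ (-Real.pi / (2 * τ) < μ ∧ μ < 0) := by
  have hpi := Real.pi_pos
  have hkey : -Real.pi / (2 * τ) < μ ↔ -(Real.pi / 2) < τ * μ := by
    rw [div_lt_iff₀ (by positivity)]
    constructor <;> intro h <;> linarith
  have hre : ∀ a b : ℝ, (((a : ℂ) + b * Complex.I) / τ).re = a / τ := by
    intro a b
    rw [Complex.div_ofReal_re]; simp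
  rw [hkey]
  constructor
  · intro h
    have h' : ∀ a b : ℝ, 0 ≤ a → Real.exp a * (a * Real.cos b - b * Real.sin b) = τ * μ →
        Real.exp a * (a * Real.sin b + b * Real.cos b) = 0 → False := by
      intro a b ha h1 h2
      have := h _ ((aux_eq τ μ a b hτ).2 ⟨h1, h2⟩)
      rw [hre] at this
      have := div_nonneg ha hτ.le
      linarith
    constructor
    · by_contra hm
      push Not at hm
      set m := -(τ * μ) with hmd
      have hm1 : Real.pi / 2 ≤ m := by linarith
      have hm2 : 1 < m := by linarith [Real.pi_gt_three]
      have hi1 : 0 < 1 / m := by positivity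
      have hi2 : 1 / m < 1 := by rw [div_lt_one (by linarith)]; exact hm2
      have has1 : 0 < Real.arcsin (1 / m) := Real.arcsin_pos.2 hi1
      have has2 : Real.arcsin (1 / m) ≤ Real.pi / 2 := Real.arcsin_le_pi_div_two _
      set c := Real.pi - Real.arcsin (1 / m) with hc
      have hsc : Real.sin c = 1 / m := by
        rw [hc, Real.sin_pi_sub, Real.sin_arcsin (by linarith) hi2.le]
      have hspos : ∀ b ∈ Set.Icc (Real.pi / 2) c, 0 < Real.sin b := fun b hb =>
        Real.sin_pos_of_pos_of_lt_pi (by linarith [hb.1]) (by linarith [hb.2])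
      have hapos : ∀ b ∈ Set.Icc (Real.pi / 2) c, 0 ≤ -b * Real.cos b / Real.sin b := by
        intro b hb
        have : Real.cos b ≤ 0 := Real.cos_nonpos_of_pi_div_two_le_of_le hb.1 (by linarith [hb.2])
        have h3 : 0 ≤ b := by linarith [hb.1]
        exact div_nonneg (by nlinarith) (hspos b hb).le
      have hcont : ContinuousOn (fun b : ℝ => Real.exp (-b * Real.cos b / Real.sin b) *
          (b / Real.sin b)) (Set.Icc (Real.pi / 2) c) := by
        have hne : ∀ b ∈ Set.Icc (Real.pi / 2) c, Real.sin b ≠ 0 := fun b hb => (hspos b hb).ne'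
        refine ContinuousOn.mul (ContinuousOn.rexp (ContinuousOn.div (by fun_prop) (by fun_prop) hne))
          (ContinuousOn.div (by fun_prop) (by fun_prop) hne)
      have hle : Real.pi / 2 ≤ c := by linarith
      have hmem : m ∈ Set.Icc ((fun b : ℝ => Real.exp (-b * Real.cos b / Real.sin b) *
          (b / Real.sin b)) (Real.pi / 2)) ((fun b : ℝ => Real.exp (-b * Real.cos b / Real.sin b) *
          (b / Real.sin b)) c) := by
        constructor
        · simpa using hm1
        · have he := Real.one_le_exp (hapos c ⟨hle, le_refl _⟩)
          have h4 : m ≤ c / Real.sin c := by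
            rw [hsc, div_div_eq_mul_div, div_one]
            nlinarith [Real.pi_gt_three]
          show m ≤ _ * _
          nlinarith
      obtain ⟨b, hb, hbm⟩ := intermediate_value_Icc hle hcont hmem
      have hs := hspos b hb
      refine h' _ b (hapos b hb) ?_ ?_
      · have : -b * Real.cos b / Real.sin b * Real.cos b - b * Real.sin b = -(b / Real.sin b) := by
          field_simp
          linear_combination (-b) * Real.sin_sq_add_cos_sq b
        rw [this]
        simp only at hbm
        linarith
      · have : -b * Real.cos b / Real.sin b * Real.sin b + b * Real.cos b = 0 := by
          field_simp
          ring
        rw [this, mul_zero]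
    · by_contra hm
      push Not at hm
      have hm' : 0 ≤ τ * μ := by positivity
      have hcont : ContinuousOn (fun a : ℝ => Real.exp a * a) (Set.Icc 0 (τ * μ)) := by fun_prop
      obtain ⟨a, ha, hh⟩ := intermediate_value_Icc hm' hcont (show τ * μ ∈ _ by
        constructor
        · simpa using hm'
        · show _ ≤ _ * _
          nlinarith [Real.one_le_exp hm'])
      exact h' a 0 ha.1 (by simpa using hh) (by simp)
  · rintro ⟨h1, h2⟩ lam hl
    by_contra hneg
    push Not at hneg
    obtain ⟨a, b, hab, ha⟩ : ∃ a b : ℝ, lam = ((a : ℂ) + b * Complex.I) / τ ∧ 0 ≤ a := by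
      refine ⟨τ * lam.re, τ * lam.im, ?_, by positivity⟩
      have h0 : (τ : ℂ) ≠ 0 := by exact_mod_cast hτ.ne'
      rw [eq_div_iff h0]
      push_cast
      linear_combination (-(τ : ℂ)) * Complex.re_add_im lam
    rw [hab, aux_eq _ _ _ _ hτ] at hl
    obtain ⟨e1, e2⟩ := hl
    have hx := Real.one_le_exp ha
    have hmneg : τ * μ < 0 := by nlinarith
    have hsq : (Real.exp a) ^ 2 * (a ^ 2 + b ^ 2) = (τ * μ) ^ 2 := by
      rw [← e1]
      linear_combination (-(Real.exp a) ^ 2 * (a ^ 2 + b ^ 2)) * Real.sin_sq_add_cos_sq b +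
        (Real.exp a * (a * Real.sin b + b * Real.cos b)) * e2
    have hb2 : b ^ 2 < (Real.pi / 2) ^ 2 := by
      have : (τ * μ) ^ 2 < (Real.pi / 2) ^ 2 := by nlinarith
      have h5 : 1 ≤ (Real.exp a) ^ 2 := by nlinarith
      nlinarith [sq_nonneg a, sq_nonneg b]
    have hb := abs_lt_of_sq_lt_sq' hb2 (by positivity)
    have hcos := Real.cos_pos_of_mem_Ioo ⟨hb.1, hb.2⟩
    have e3 : a * Real.sin b + b * Real.cos b = 0 := by
      rcases mul_eq_zero.1 e2 with h | h
      · linarith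
      · exact h
    have hbs : 0 ≤ b * Real.sin b := by
      rcases le_total 0 b with h | h
      · exact mul_nonneg h (Real.sin_nonneg_of_nonneg_of_le_pi h (by linarith [hb.2]))
      · exact mul_nonneg_of_nonpos_of_nonpos h
          (Real.sin_nonpos_of_nonpos_of_neg_pi_le h (by linarith [hb.1]))
    have hb0 : b = 0 := by
      by_contra hne
      have h6 : 0 < b ^ 2 := by positivity
      have h7 : a * (b * Real.sin b) + b ^ 2 * Real.cos b = 0 := by linear_combination b * e3
      have := mul_nonneg ha hbs
      have := mul_pos h6 hcos
      linarith
    subst hb0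
    simp at e1
    have : 0 ≤ Real.exp a * a := by positivity
    linarith
end

section
/- Let D_u > 0, D_v > 0 and let t, d, p be real numbers. Define T(Λ) = t + (D_u + D_v)Λ and D(Λ) = d + pΛ + D_u D_v Λ², and for Λ with T(Λ)² − 4D(Λ) > 0 define μ₂(Λ) = (T(Λ) + √(T(Λ)² − 4D(Λ)))/2. If Λ₀ is a real number with T(Λ₀)² − 4D(Λ₀) > 0 and the derivative of μ₂ at Λ₀ is zero, then Λ₀ satisfies c₂ Λ₀² + c₁ Λ₀ + c₀ = 0, where c₂ = −D_u D_v (D_u − D_v)², c₁ = 4 D_u D_v p − 2 D_u D_v t (D_u + D_v), and c₀ = d (D_u + D_v)² + p² − t p (D_u + D_v). -/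
/-- Critical points of the largest mode eigenvalue
`μ₂(Λ) = (T(Λ) + √(T(Λ)² - 4D(Λ)))/2`, with `T(Λ) = t + (D_u + D_v)Λ` and
`D(Λ) = d + pΛ + D_u D_v Λ²`, satisfy the quadratic `c₂Λ² + c₁Λ + c₀ = 0`. -/
theorem stmt_12 (Du Dv t d p : ℝ) (hDu : 0 < Du) (hDv : 0 < Dv) (Λ₀ : ℝ)
    (hdisc : (t + (Du + Dv) * Λ₀) ^ 2 - 4 * (d + p * Λ₀ + Du * Dv * Λ₀ ^ 2) > 0)
    (hderiv : HasDerivAt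
      (fun Λ : ℝ => ((t + (Du + Dv) * Λ)
          + Real.sqrt ((t + (Du + Dv) * Λ) ^ 2
              - 4 * (d + p * Λ + Du * Dv * Λ ^ 2))) / 2) 0 Λ₀) :
    (-(Du * Dv) * (Du - Dv) ^ 2) * Λ₀ ^ 2
      + (4 * Du * Dv * p - 2 * Du * Dv * t * (Du + Dv)) * Λ₀
      + (d * (Du + Dv) ^ 2 + p ^ 2 - t * p * (Du + Dv)) = 0 := by
  have hT : HasDerivAt (fun Λ : ℝ => t + (Du + Dv) * Λ) (Du + Dv) Λ₀ := by
    simpa using ((hasDerivAt_id Λ₀).const_mul (Du + Dv)).const_add t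
  have hD : HasDerivAt (fun Λ : ℝ => d + p * Λ + Du * Dv * Λ ^ 2)
      (p + Du * Dv * (2 * Λ₀)) Λ₀ := by
    have h1 : HasDerivAt (fun Λ : ℝ => d + p * Λ) p Λ₀ := by
      simpa using ((hasDerivAt_id Λ₀).const_mul p).const_add d
    have h2 : HasDerivAt (fun Λ : ℝ => Du * Dv * Λ ^ 2) (Du * Dv * (2 * Λ₀)) Λ₀ := by
      simpa using (hasDerivAt_pow 2 Λ₀).const_mul (Du * Dv)
    exact h1.add h2
  have hQ := (hT.pow 2).sub (hD.const_mul 4)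
  have hF := (hT.add (hQ.sqrt hdisc.ne')).div_const 2
  have h0 := hF.unique hderiv
  have hs := Real.sq_sqrt hdisc.le
  have hp := Real.sqrt_pos.mpr hdisc
  simp only [Pi.sub_apply, Pi.pow_apply] at h0
  set r := Real.sqrt ((t + (Du + Dv) * Λ₀) ^ 2 - 4 * (d + p * Λ₀ + Du * Dv * Λ₀ ^ 2)) with hr
  have hr0 : r ≠ 0 := hp.ne'
  field_simp at h0
  norm_num at h0
  have h3 : (Du + Dv) * r = -((t + (Du + Dv) * Λ₀) * (Du + Dv) - 2 * (p + Du * Dv * (2 * Λ₀))) := by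
    linarith
  have h4 := congrArg (fun x => x ^ 2) h3
  simp only [mul_pow, hs] at h4
  linear_combination (-1 / 4) * h4
end

section
/- Let D_u > 0, D_v > 0, and let t < 0, d, p be real numbers with p > 0. Define T(Λ) = t + (D_u + D_v)Λ and D(Λ) = d + pΛ + D_u D_v Λ², and for Λ with T(Λ)² − 4D(Λ) > 0 define μ₁(Λ) = (T(Λ) − √(T(Λ)² − 4D(Λ)))/2. Then for every Λ₀ ≤ 0 with T(Λ₀)² − 4D(Λ₀) > 0, the derivative of μ₁ at Λ₀ is strictly positive. -/
/-- Monotonicity of the smallest mode eigenvalue: with `t = tr J < 0` and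
`p = f_{u_τ} D_v + g_{v_τ} D_u > 0`, the function
`μ₁(Λ) = (T(Λ) - √(T(Λ)² - 4D(Λ)))/2` has strictly positive derivative at every
`Λ₀ ≤ 0` where the discriminant is positive. -/
theorem stmt_13 (Du Dv t d p : ℝ) (hDu : 0 < Du) (hDv : 0 < Dv)
    (ht : t < 0) (hp : 0 < p) (Λ₀ : ℝ) (hΛ₀ : Λ₀ ≤ 0)
    (hdisc : (t + (Du + Dv) * Λ₀) ^ 2 - 4 * (d + p * Λ₀ + Du * Dv * Λ₀ ^ 2) > 0) :
    ∃ m : ℝ, 0 < m ∧ HasDerivAt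
      (fun Λ : ℝ => ((t + (Du + Dv) * Λ)
          - Real.sqrt ((t + (Du + Dv) * Λ) ^ 2
              - 4 * (d + p * Λ + Du * Dv * Λ ^ 2))) / 2) m Λ₀ := by
  have hs := Real.sqrt_pos.mpr hdisc
  have hT : HasDerivAt (fun Λ : ℝ => t + (Du + Dv) * Λ) (Du + Dv) Λ₀ := by
    simpa using ((hasDerivAt_id Λ₀).const_mul (Du + Dv)).const_add t
  have hD : HasDerivAt (fun Λ : ℝ => d + p * Λ + Du * Dv * Λ ^ 2)
      (p + Du * Dv * (2 * Λ₀)) Λ₀ := by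
    have h1 : HasDerivAt (fun Λ : ℝ => d + p * Λ) p Λ₀ := by
      simpa using ((hasDerivAt_id Λ₀).const_mul p).const_add d
    have h2 : HasDerivAt (fun Λ : ℝ => Du * Dv * Λ ^ 2) (Du * Dv * (2 * Λ₀)) Λ₀ := by
      simpa using (hasDerivAt_pow 2 Λ₀).const_mul (Du * Dv)
    exact h1.add h2
  have hE := (hT.pow 2).sub (hD.const_mul 4)
  have hF := (hT.sub (hE.sqrt hdisc.ne')).div_const 2
  refine ⟨_, ?_, hF⟩
  have key : (2 * (t + (Du + Dv) * Λ₀) * (Du + Dv) - 4 * (p + Du * Dv * (2 * Λ₀))) <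
      (Du + Dv) * (2 * Real.sqrt ((t + (Du + Dv) * Λ₀) ^ 2
        - 4 * (d + p * Λ₀ + Du * Dv * Λ₀ ^ 2))) := by
    have h1 : 0 < (Du + Dv) * Real.sqrt ((t + (Du + Dv) * Λ₀) ^ 2
        - 4 * (d + p * Λ₀ + Du * Dv * Λ₀ ^ 2)) := by positivity
    have h2 : 0 < (Du + Dv) * (-t) := mul_pos (by linarith) (by linarith)
    have h3 : 0 ≤ (Du - Dv) ^ 2 * (-Λ₀) := mul_nonneg (sq_nonneg _) (by linarith)
    linarith
  apply half_pos
  rw [sub_pos]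
  refine (div_lt_iff₀ (mul_pos two_pos hs)).mpr ?_
  simpa using key
end

section
/- Let f_u > 0, g_v < 0, and f_v, g_u be real numbers such that (f_u + g_v)² − 4(f_u g_v − f_v g_u) < 0, and let 0 < D_u < D_v. Then f_v · g_u < 0, and setting Λ₀ = (f_u − g_v − 2√(−f_v g_u)) / (D_v − D_u), for every real Λ ≤ Λ₀ one has ((f_u + g_v) + (D_u + D_v)Λ)² − 4((f_u g_v − f_v g_u) + (f_u D_v + g_v D_u)Λ + D_u D_v Λ²) ≥ 0. -/
/-- If the reaction Jacobian has nonreal eigenvalues (`(tr J)² - 4 det J < 0`) and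
`D_u < D_v`, then `f_v g_u < 0` and for every Laplacian eigenvalue
`Λ ≤ Λ₀ = (f_u - g_v - 2√(-f_v g_u))/(D_v - D_u)` the mode matrix
`J^Λ = J + diag(D_u, D_v)Λ` has nonnegative discriminant, hence real eigenvalues. -/
theorem stmt_15 (fu fv gu gv Du Dv : ℝ) (hfu : 0 < fu) (hgv : gv < 0)
    (hdisc : (fu + gv) ^ 2 - 4 * (fu * gv - fv * gu) < 0)
    (hDu : 0 < Du) (hDuv : Du < Dv) :
    fv * gu < 0 ∧
    ∀ Λ : ℝ, Λ ≤ (fu - gv - 2 * Real.sqrt (-(fv * gu))) / (Dv - Du) →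
      ((fu + gv) + (Du + Dv) * Λ) ^ 2
        - 4 * ((fu * gv - fv * gu) + (fu * Dv + gv * Du) * Λ + Du * Dv * Λ ^ 2)
        ≥ 0 := by
  have hneg : fv * gu < 0 := by nlinarith [sq_nonneg (fu - gv)]
  refine ⟨hneg, fun Λ hΛ => ?_⟩
  rw [le_div_iff₀ (sub_pos.mpr hDuv)] at hΛ
  have hs := Real.sqrt_nonneg (-(fv * gu))
  have hq := Real.sq_sqrt (show 0 ≤ -(fv * gu) by linarith)
  set s := Real.sqrt (-(fv * gu))
  have hX : 2 * s ≤ fu - gv - Λ * (Dv - Du) := by linarith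
  have h2 : (2 * s) ^ 2 ≤ (fu - gv - Λ * (Dv - Du)) ^ 2 :=
    pow_le_pow_left₀ (by linarith) hX 2
  nlinarith [h2, hq]
end

section
/- Let T < 0, D > 0, and τ > 0 be real numbers with 1 + τT ≠ 0. Then every complex root λ of the quadratic (1 + τT) λ² − (2τD + T) λ + D = 0 has strictly negative real part if and only if τ < min(−1/T, −T/(2D)). -/
theorem quad_aux (a b D : ℝ) (ha : a ≠ 0) (hD : 0 < D) :
    (∀ lam : ℂ, (a : ℂ) * lam ^ 2 - (b : ℂ) * lam + (D : ℂ) = 0 → lam.re < 0)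
      ↔ 0 < a ∧ b < 0 := by
  have key : ∀ lam : ℂ, (a : ℂ) * lam ^ 2 - (b : ℂ) * lam + (D : ℂ) = 0 ↔
      (a * (lam.re ^ 2 - lam.im ^ 2) - b * lam.re + D = 0 ∧
        lam.im * (2 * a * lam.re - b) = 0) := by
    intro lam
    rw [Complex.ext_iff]
    simp only [pow_two, Complex.add_re, Complex.sub_re, Complex.mul_re, Complex.add_im,
      Complex.sub_im, Complex.mul_im, Complex.ofReal_re, Complex.ofReal_im, Complex.zero_re,
      Complex.zero_im]
    constructor
    · rintro ⟨h1, h2⟩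
      exact ⟨by linarith, by linarith⟩
    · rintro ⟨h1, h2⟩
      exact ⟨by linarith, by linarith⟩
  simp only [key]
  constructor
  · intro h
    have hre : ∀ x y : ℝ, a * (x ^ 2 - y ^ 2) - b * x + D = 0 → y * (2 * a * x - b) = 0 →
        x < 0 := fun x y h1 h2 => h ⟨x, y⟩ ⟨h1, h2⟩
    have hapos : 0 < a := by
      by_contra hn
      have han : a < 0 := lt_of_le_of_ne (not_lt.mp hn) ha
      have hd : 0 ≤ b ^ 2 - 4 * a * D := by nlinarith [sq_nonneg b, mul_pos (neg_pos.mpr han) hD]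
      have hs := Real.sq_sqrt hd
      have hsb : b ≤ √(b ^ 2 - 4 * a * D) := by
        apply Real.le_sqrt_of_sq_le
        nlinarith [mul_pos (neg_pos.mpr han) hD]
      set s := √(b ^ 2 - 4 * a * D)
      have := hre ((b - s) / (2 * a)) 0 (by field_simp; linarith) (by ring)
      have h2 : 0 ≤ (b - s) / (2 * a) := div_nonneg_of_nonpos (by linarith) (by linarith)
      linarith
    refine ⟨hapos, ?_⟩
    by_contra hb
    push Not at hb
    rcases le_total 0 (b ^ 2 - 4 * a * D) with hd | hd
    · have hs := Real.sq_sqrt hd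
      have hs0 := Real.sqrt_nonneg (b ^ 2 - 4 * a * D)
      set s := √(b ^ 2 - 4 * a * D)
      have := hre ((b + s) / (2 * a)) 0 (by field_simp; linarith) (by ring)
      have h2 : 0 ≤ (b + s) / (2 * a) := by positivity
      linarith
    · have hs := Real.sq_sqrt (neg_nonneg.mpr hd)
      set s := √(-(b ^ 2 - 4 * a * D))
      have := hre (b / (2 * a)) (s / (2 * a)) (by field_simp; linarith)
        (by field_simp; ring)
      have h2 : 0 ≤ b / (2 * a) := by positivity
      linarith
  · rintro ⟨ha, hb⟩ lam ⟨h1, h2⟩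
    by_contra hx
    push Not at hx
    rcases mul_eq_zero.mp h2 with hy | hy
    · rw [hy] at h1
      nlinarith [mul_nonneg ha.le (sq_nonneg lam.re), mul_nonneg (neg_nonneg.mpr hb.le) hx]
    · nlinarith [mul_nonneg ha.le hx]


/-- Small-delay approximation stability criterion: with `T = tr J^α < 0`,
`D = det J^α > 0`, `τ > 0` and `1 + τT ≠ 0`, every complex root of
`(1 + τT)λ² - (2τD + T)λ + D = 0` has negative real part iff
`τ < min(-1/T, -T/(2D))`. -/
theorem stmt_17 (T D τ : ℝ) (hT : T < 0) (hD : 0 < D) (hτ : 0 < τ)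
    (hden : 1 + τ * T ≠ 0) :
    (∀ lam : ℂ,
        ((1 + τ * T : ℝ) : ℂ) * lam ^ 2 - ((2 * τ * D + T : ℝ) : ℂ) * lam
          + ((D : ℝ) : ℂ) = 0 → lam.re < 0)
      ↔ τ < min (-1 / T) (-T / (2 * D)) := by
  rw [quad_aux _ _ _ hden hD, lt_min_iff, lt_div_iff_of_neg hT, lt_div_iff₀ (by positivity)]
  constructor
  · rintro ⟨h1, h2⟩
    exact ⟨by linarith, by linarith⟩
  · rintro ⟨h1, h2⟩
    exact ⟨by linarith, by linarith⟩
end
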